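/- arXiv:2312.16033 — 4 statements merged into one kernel-verified Lean document; each statement's English description precedes it below -/
import Mathlib

section
/- Let r be a table, E an embedding with A, B ∈ E, and r^E the set of tuples of r with no missing values on E. The embedded order dependency E: A ↦≤ B is valid if and only if there is neither a split nor a swap on the attribute pair (A, B) among the tuples of r^E. -/
variable {α V : Type*} [LinearOrder V]

/-- `restrict r E` is `r^E`: the tuples of the table `r` having no missing value
(`⊥`) on any attribute of the embedding `E`. -/
def restrict (r : Finset (α → WithBot V)) (E : Finset α) : Set (α → WithBot V) :=
  {t | t ∈ r ∧ ∀ C ∈ E, t C ≠ ⊥}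

/-- The embedded order dependency `E : A ↦≤ B` is valid on the table `r`. -/
def eODle (r : Finset (α → WithBot V)) (E : Finset α) (A B : α) : Prop :=
  ∀ s ∈ restrict r E, ∀ t ∈ restrict r E, s A ≤ t A → s B ≤ t B

/-- The embedded order dependency `E : A ↦< B` is valid on the table `r`. -/
def eODlt (r : Finset (α → WithBot V)) (E : Finset α) (A B : α) : Prop :=
  ∀ s ∈ restrict r E, ∀ t ∈ restrict r E, s A < t A → s B < t B

/-- `(s,t)` has a split on `(A,B)`: `s_A = t_A` but `s_B ≠ t_B`. -/
def HasSplit (s t : α → WithBot V) (A B : α) : Prop := s A = t A ∧ s B ≠ t B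

/-- `(s,t)` has a merge on `(A,B)`: `s_A ≠ t_A` but `s_B = t_B`. -/
def HasMerge (s t : α → WithBot V) (A B : α) : Prop := s A ≠ t A ∧ s B = t B

/-- `(s,t)` has a swap on `(A,B)`: `s_A < t_A` but `s_B > t_B`. -/
def HasSwap (s t : α → WithBot V) (A B : α) : Prop := s A < t A ∧ t B < s B

/-- The eOD `E : A ↦≤ B` is valid iff there is neither a split nor a swap on
`(A, B)` among the tuples of `r^E`. -/
theorem eODle_iff_no_split_no_swap
    (r : Finset (α → WithBot V)) (E : Finset α) (A B : α)
    (hA : A ∈ E) (hB : B ∈ E) :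
    eODle r E A B ↔
      ¬ ∃ s ∈ restrict r E, ∃ t ∈ restrict r E,
          HasSplit s t A B ∨ HasSwap s t A B := by
  constructor
  · rintro h ⟨s, hs, t, ht, ⟨hsA, hsB⟩ | ⟨hsA, hsB⟩⟩
    · exact hsB (le_antisymm (h s hs t ht hsA.le) (h t ht s hs hsA.ge))
    · exact hsB.not_ge (h s hs t ht hsA.le)
  · intro h s hs t ht hst
    by_contra hlt
    rw [not_le] at hlt
    rcases hst.eq_or_lt with heq | hA_lt
    · exact h ⟨s, hs, t, ht, Or.inl ⟨heq, hlt.ne'⟩⟩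
    · exact h ⟨s, hs, t, ht, Or.inr ⟨hA_lt, hlt⟩⟩
end

section
/- Let r be a table, E an embedding with A, B ∈ E, and r^E the set of tuples of r with no missing values on E. The embedded order dependency E: A ↦< B is valid if and only if there is neither a merge nor a swap on the attribute pair (A, B) among the tuples of r^E. -/
variable {α V : Type*} [LinearOrder V]

/-- The eOD `E : A ↦< B` is valid iff there is neither a merge nor a swap on
`(A, B)` among the tuples of `r^E`. -/
theorem eODlt_iff_no_merge_no_swap
    (r : Finset (α → WithBot V)) (E : Finset α) (A B : α)
    (hA : A ∈ E) (hB : B ∈ E) :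
    eODlt r E A B ↔
      ¬ ∃ s ∈ restrict r E, ∃ t ∈ restrict r E,
          HasMerge s t A B ∨ HasSwap s t A B := by
  constructor
  · rintro h ⟨s, hs, t, ht, ⟨hne, heq⟩ | ⟨hlt, hgt⟩⟩
    · rcases lt_or_gt_of_ne hne with hlt | hgt
      · exact (h s hs t ht hlt).ne heq
      · exact (h t ht s hs hgt).ne' heq
    · exact (h s hs t ht hlt).asymm hgt
  · intro h s hs t ht hlt
    by_contra hB'
    rcases (not_lt.mp hB').eq_or_lt with heq | hgt
    · exact h ⟨s, hs, t, ht, Or.inl ⟨hlt.ne, heq.symm⟩⟩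
    · exact h ⟨s, hs, t, ht, Or.inr ⟨hlt, hgt⟩⟩
end

section
/- Let r be a table, E an embedding with A, B ∈ E, and suppose tuples s, t ∈ r^E form a swap or a merge on (A, B) and both s and t have no missing value on any attribute of R (they are complete tuples). Then for every embedding E' with E ⊆ E' ⊆ R, the embedded order dependency E': A ↦< B is invalid. -/
variable {α V : Type*} [LinearOrder V]

/-- If two complete tuples of `r^E` form a swap or merge on `(A, B)`, then
`E' : A ↦< B` is invalid for every embedding `E'` with `E ⊆ E'` (note that
`E' ⊆ R` automatically, since `R` is the whole attribute type `α`). -/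
theorem complete_error_invalidates_all_extensions
    (r : Finset (α → WithBot V)) (E E' : Finset α) (A B : α)
    (hA : A ∈ E) (hB : B ∈ E)
    (s t : α → WithBot V) (hs : s ∈ restrict r E) (ht : t ∈ restrict r E)
    (herr : HasSwap s t A B ∨ HasMerge s t A B)
    (hsc : ∀ C : α, s C ≠ ⊥) (htc : ∀ C : α, t C ≠ ⊥)
    (hEE' : E ⊆ E') :
    ¬ eODlt r E' A B := by
  intro h
  have hs' : s ∈ restrict r E' := ⟨hs.1, fun C _ => hsc C⟩
  have ht' : t ∈ restrict r E' := ⟨ht.1, fun C _ => htc C⟩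
  rcases herr with ⟨hlt, hgt⟩ | ⟨hne, heq⟩
  · exact lt_asymm hgt (h s hs' t ht' hlt)
  · rcases lt_or_gt_of_ne hne with hlt | hgt
    · exact (h s hs' t ht' hlt).ne heq
    · exact (h t ht' s hs' hgt).ne' heq
end

section
/- Let r be a table and E' an embedding with A, B ∈ E'. The embedded order dependency E': A ↦< B is valid if and only if for every pair of tuples s, t ∈ r that have no missing values on A and B and that form a merge or a swap on (A, B), at least one of s, t has a missing value on some attribute of E' (i.e., at least one of s, t does not belong to r^{E'}). -/
variable {α V : Type*} [LinearOrder V]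

/-- `E' : A ↦< B` is valid iff every pair of tuples of `r` with no missing
values on `A` and `B` forming a merge or a swap on `(A, B)` has at least one
member missing a value on some attribute of `E'` (i.e., not in `r^{E'}`). -/
theorem eODlt_iff_all_errors_removed
    (r : Finset (α → WithBot V)) (E' : Finset α) (A B : α)
    (hA : A ∈ E') (hB : B ∈ E') :
    eODlt r E' A B ↔
      ∀ s ∈ r, ∀ t ∈ r,
        s A ≠ ⊥ → s B ≠ ⊥ → t A ≠ ⊥ → t B ≠ ⊥ →
        (HasMerge s t A B ∨ HasSwap s t A B) →
        (s ∉ restrict r E' ∨ t ∉ restrict r E') := by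
  constructor
  · intro h s _ t _ _ _ _ _ hst
    by_contra! hmem
    obtain ⟨hs, ht⟩ := hmem
    rcases hst with ⟨hne, heq⟩ | ⟨hlt, hgt⟩
    · rcases lt_or_gt_of_ne hne with hlt | hgt
      · exact (h s hs t ht hlt).ne heq
      · exact (h t ht s hs hgt).ne' heq
    · exact (h s hs t ht hlt).not_gt hgt
  · intro h s hs t ht hlt
    by_contra! hle
    have herr : HasMerge s t A B ∨ HasSwap s t A B :=
      hle.eq_or_lt.imp (fun heq => ⟨hlt.ne, heq.symm⟩) (fun hgt => ⟨hlt, hgt⟩)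
    rcases h s hs.1 t ht.1 (hs.2 A hA) (hs.2 B hB) (ht.2 A hA) (ht.2 B hB) herr with hn | hn
    · exact hn hs
    · exact hn ht
end
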